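/- For every integer k ≥ 2, the complete graph K_k (viewed as a hypergraph whose hyperedges are all 2-element subsets of a k-element vertex set) satisfies κ(K_k) = k/2 and ψ*(K_k) = k − 1. -/

import Mathlib

open Finset

variable {α : Type*} [DecidableEq α]

/-- Total weights achievable by fractional edge covers of the hypergraph `(V, E)`. -/
def coverWeights (V : Finset α) (E : Finset (Finset α)) : Set ℝ :=
  {w | ∃ u : Finset α → ℝ, (∀ e ∈ E, 0 ≤ u e) ∧
    (∀ v ∈ V, 1 ≤ ∑ e ∈ E.filter (fun e => v ∈ e), u e) ∧
    w = ∑ e ∈ E, u e}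

/-- Total weights achievable by fractional edge packings of the hypergraph `(V, E)`. -/
def packingWeights (V : Finset α) (E : Finset (Finset α)) : Set ℝ :=
  {w | ∃ u : Finset α → ℝ, (∀ e ∈ E, 0 ≤ u e) ∧
    (∀ v ∈ V, ∑ e ∈ E.filter (fun e => v ∈ e), u e ≤ 1) ∧
    w = ∑ e ∈ E, u e}

/-- `ρ*`: the minimum total weight of a fractional edge cover. -/
noncomputable def rhoStar (V : Finset α) (E : Finset (Finset α)) : ℝ :=
  sInf (coverWeights V E)

/-- `τ*`: the maximum total weight of a fractional edge packing. -/
noncomputable def tauStar (V : Finset α) (E : Finset (Finset α)) : ℝ :=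
  sSup (packingWeights V E)

/-- Edge set of the induced subhypergraph `H[S]`. -/
def induced (E : Finset (Finset α)) (S : Finset α) : Finset (Finset α) :=
  (E.image (fun e => e ∩ S)).filter (fun e => e ≠ ∅)

/-- Edge set of the reduced hypergraph `red(H)`: edges strictly contained in
another edge are removed. -/
def reduce (E : Finset (Finset α)) : Finset (Finset α) :=
  E.filter (fun e => ∀ e' ∈ E, e ⊆ e' → e = e')

/-- `κ`: the reduced quasi vertex-cover. -/
noncomputable def kappa (V : Finset α) (E : Finset (Finset α)) : ℝ :=
  V.powerset.sup' V.powerset_nonempty (fun S => tauStar S (reduce (induced E S)))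

/-- `ψ*`: the edge quasi-packing. -/
noncomputable def psiStar (V : Finset α) (E : Finset (Finset α)) : ℝ :=
  V.powerset.sup' V.powerset_nonempty (fun S => tauStar S (induced E S))

/-- Counting incidences: edges of size at least `m` bound `m` times the weight of any packing by
the number of vertices. -/
theorem mul_le_card_of_mem_packingWeights {S : Finset α} {E : Finset (Finset α)} {m : ℕ}
    (hsub : ∀ e ∈ E, e ⊆ S) (hcard : ∀ e ∈ E, m ≤ #e) {w : ℝ}
    (hw : w ∈ packingWeights S E) : m * w ≤ #S := by
  obtain ⟨u, hu, hv, rfl⟩ := hw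
  calc (m : ℝ) * ∑ e ∈ E, u e = ∑ e ∈ E, m * u e := Finset.mul_sum ..
    _ ≤ ∑ e ∈ E, ∑ v ∈ S, if v ∈ e then u e else 0 := by
      refine Finset.sum_le_sum fun e he => ?_
      rw [← Finset.sum_filter, Finset.sum_const, nsmul_eq_mul, Finset.filter_mem_eq_inter,
        Finset.inter_eq_right.2 (hsub e he)]
      exact mul_le_mul_of_nonneg_right (by exact_mod_cast hcard e he) (hu e he)
    _ = ∑ v ∈ S, ∑ e ∈ E.filter (fun e => v ∈ e), u e := by
      rw [Finset.sum_comm]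
      simp only [Finset.sum_filter]
    _ ≤ ∑ v ∈ S, (1 : ℝ) := Finset.sum_le_sum hv
    _ = #S := by simp

theorem tauStar_le_card_div {S : Finset α} {E : Finset (Finset α)} {m : ℕ} (hm : 0 < m)
    (hsub : ∀ e ∈ E, e ⊆ S) (hcard : ∀ e ∈ E, m ≤ #e) : tauStar S E ≤ #S / m := by
  refine csSup_le ⟨0, fun _ => 0, by simp, by simp, by simp⟩ fun w hw => ?_
  rw [le_div_iff₀ (by exact_mod_cast hm), mul_comm]
  exact mul_le_card_of_mem_packingWeights hsub hcard hw

theorem le_tauStar {S : Finset α} {E : Finset (Finset α)}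
    (hsub : ∀ e ∈ E, e ⊆ S) (hne : ∀ e ∈ E, e ≠ ∅) {w : ℝ}
    (hw : w ∈ packingWeights S E) : w ≤ tauStar S E := by
  refine le_csSup ⟨#S, fun x hx => ?_⟩ hw
  simpa using mul_le_card_of_mem_packingWeights (m := 1) hsub
    (fun e he => Finset.card_pos.2 (Finset.nonempty_iff_ne_empty.2 (hne e he))) hx

theorem mem_induced {E : Finset (Finset α)} {S e : Finset α} :
    e ∈ induced E S ↔ (∃ f ∈ E, f ∩ S = e) ∧ e ≠ ∅ := by
  simp [induced]

theorem subset_of_mem_induced {E : Finset (Finset α)} {S e : Finset α}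
    (he : e ∈ induced E S) : e ⊆ S := by
  obtain ⟨⟨f, -, rfl⟩, -⟩ := mem_induced.1 he
  exact Finset.inter_subset_right

theorem tauStar_induced_le_card (E : Finset (Finset α)) (S : Finset α) :
    tauStar S (induced E S) ≤ #S := by
  simpa using tauStar_le_card_div one_pos (fun e => subset_of_mem_induced (E := E) (S := S))
    fun e he => Finset.card_pos.2 (Finset.nonempty_iff_ne_empty.2 (mem_induced.1 he).2)

theorem tauStar_reduce_induced_le_card (E : Finset (Finset α)) (S : Finset α) :
    tauStar S (reduce (induced E S)) ≤ #S := by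
  simpa using tauStar_le_card_div (E := reduce (induced E S)) (S := S) one_pos
    (fun e he => subset_of_mem_induced (Finset.mem_filter.1 he).1)
    fun e he => Finset.card_pos.2 (Finset.nonempty_iff_ne_empty.2
      (mem_induced.1 (Finset.mem_filter.1 he).1).2)

/-- If every vertex is a singleton edge, giving weight one to each singleton is a packing. -/
theorem card_le_tauStar_of_singleton_mem {S : Finset α} {E : Finset (Finset α)}
    (hsub : ∀ e ∈ E, e ⊆ S) (hne : ∀ e ∈ E, e ≠ ∅) (hS : ∀ v ∈ S, {v} ∈ E) :
    (#S : ℝ) ≤ tauStar S E := by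
  refine le_trans ?_ (le_tauStar hsub hne
    ⟨fun e => if #e = 1 then 1 else 0, fun e _ => by positivity, fun v _ => ?_, rfl⟩)
  · rw [Finset.sum_boole]
    rw [← Finset.card_image_of_injective S Finset.singleton_injective]
    gcongr
    intro e he
    obtain ⟨v, hv, rfl⟩ := Finset.mem_image.1 he
    simpa using hS v hv
  · rw [Finset.sum_boole]
    have h : ((E.filter (fun e => v ∈ e)).filter (fun e => #e = 1)) ⊆ {{v}} := by
      intro e he
      simp only [Finset.mem_filter, Finset.card_eq_one] at he
      obtain ⟨⟨-, hv⟩, a, rfl⟩ := he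
      simp_all
    exact_mod_cast Finset.card_le_card h

theorem induced_powersetCard_self (V : Finset α) {m : ℕ} (hm : m ≠ 0) :
    induced (V.powersetCard m) V = V.powersetCard m := by
  ext e
  rw [mem_induced]
  constructor
  · rintro ⟨⟨f, hf, rfl⟩, -⟩
    rwa [Finset.inter_eq_left.2 (Finset.mem_powersetCard.1 hf).1]
  · intro he
    refine ⟨⟨e, he, Finset.inter_eq_left.2 (Finset.mem_powersetCard.1 he).1⟩, ?_⟩
    rintro rfl
    exact hm (Finset.mem_powersetCard.1 he).2.symm

theorem reduce_powersetCard (V : Finset α) (m : ℕ) :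
    reduce (V.powersetCard m) = V.powersetCard m := by
  refine Finset.filter_true_of_mem fun e he f hf hef => ?_
  rw [Finset.mem_powersetCard] at he hf
  exact Finset.eq_of_subset_of_card_le hef (by omega)

theorem card_filter_mem_powersetCard_two_le {V : Finset α} {v : α} (hv : v ∈ V) :
    #((V.powersetCard 2).filter (fun e => v ∈ e)) ≤ #V - 1 := by
  rw [← Finset.card_erase_of_mem hv]
  refine (Finset.card_le_card (t := (V.erase v).image fun w => {v, w}) fun e he => ?_).trans
    Finset.card_image_le
  simp only [Finset.mem_filter, Finset.mem_powersetCard] at he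
  obtain ⟨⟨hsub, hc⟩, hve⟩ := he
  obtain ⟨w, hw⟩ := Finset.card_eq_one.1
    (show #(e.erase v) = 1 by rw [Finset.card_erase_of_mem hve, hc])
  have hwe : w ∈ e.erase v := by simp [hw]
  refine Finset.mem_image.2 ⟨w, Finset.erase_subset_erase v hsub hwe, ?_⟩
  rw [← hw, Finset.insert_erase hve]

theorem tauStar_powersetCard_two {V : Finset α} (hV : 2 ≤ #V) :
    tauStar V (V.powersetCard 2) = #V / 2 := by
  have hsub : ∀ e ∈ V.powersetCard 2, e ⊆ V := fun e he => (Finset.mem_powersetCard.1 he).1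
  have hcard : ∀ e ∈ V.powersetCard 2, #e = 2 := fun e he => (Finset.mem_powersetCard.1 he).2
  have hpos : (0 : ℝ) < #V - 1 := by
    have : (2 : ℝ) ≤ #V := by exact_mod_cast hV
    linarith
  refine le_antisymm
    (by exact_mod_cast tauStar_le_card_div two_pos hsub fun e he => (hcard e he).ge)
    (le_tauStar hsub ?_ ⟨fun _ => 1 / (#V - 1), fun _ _ => by positivity, fun v hv => ?_, ?_⟩)
  · rintro e he rfl
    simpa using hcard _ he
  · rw [Finset.sum_const, nsmul_eq_mul, mul_one_div, div_le_one hpos,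
      ← Nat.cast_pred (by omega)]
    exact_mod_cast card_filter_mem_powersetCard_two_le hv
  · rw [Finset.sum_const, nsmul_eq_mul, Finset.card_powersetCard, Nat.cast_choose_two]
    field_simp

theorem tauStar_reduce_induced_powersetCard_two_le {V S : Finset α} (hV : 2 ≤ #V)
    (hS : S ⊆ V) : tauStar S (reduce (induced (V.powersetCard 2) S)) ≤ #V / 2 := by
  have hV' : (2 : ℝ) ≤ #V := by exact_mod_cast hV
  rcases Nat.lt_or_ge #S 2 with h | h
  · have h1 : (#S : ℝ) ≤ 1 := by exact_mod_cast Nat.le_of_lt_succ h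
    linarith [tauStar_reduce_induced_le_card (V.powersetCard 2) S]
  · have hSV : (#S : ℝ) ≤ #V := by exact_mod_cast Finset.card_le_card hS
    have key : tauStar S (reduce (induced (V.powersetCard 2) S)) ≤ #S / (2 : ℕ) := by
      refine tauStar_le_card_div two_pos
        (fun e he => subset_of_mem_induced (Finset.mem_filter.1 he).1) fun e he => ?_
      obtain ⟨he, hmax⟩ := Finset.mem_filter.1 he
      by_contra! hlt
      have hpos := Finset.card_pos.2 (Finset.nonempty_iff_ne_empty.2 (mem_induced.1 he).2)
      obtain ⟨a, rfl⟩ := Finset.card_eq_one.1 (show #e = 1 by omega)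
      have ha : a ∈ S := by simpa using subset_of_mem_induced he
      obtain ⟨b, hb, hba⟩ := Finset.exists_mem_ne h a
      have hab : ({a, b} : Finset α) ⊆ S := by
        simp [Finset.insert_subset_iff, ha, hb]
      have hmem : ({a, b} : Finset α) ∈ induced (V.powersetCard 2) S :=
        mem_induced.2 ⟨⟨{a, b}, Finset.mem_powersetCard.2
          ⟨hab.trans hS, Finset.card_pair hba.symm⟩, Finset.inter_eq_left.2 hab⟩, by simp⟩
      have hb' : b ∈ ({a} : Finset α) := by
        rw [hmax _ hmem (by simp)]
        simp
      exact hba (Finset.mem_singleton.1 hb')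
    push_cast at key
    linarith

theorem kappa_powersetCard_two {V : Finset α} (hV : 2 ≤ #V) :
    kappa V (V.powersetCard 2) = #V / 2 := by
  refine le_antisymm (Finset.sup'_le _ _ fun S hS =>
    tauStar_reduce_induced_powersetCard_two_le hV (Finset.mem_powerset.1 hS)) ?_
  refine le_trans (le_of_eq ?_) (Finset.le_sup' _ (Finset.mem_powerset_self V))
  rw [induced_powersetCard_self V two_ne_zero, reduce_powersetCard, tauStar_powersetCard_two hV]

theorem psiStar_powersetCard_two {V : Finset α} (hV : 2 ≤ #V) :
    psiStar V (V.powersetCard 2) = #V - 1 := by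
  have hV' : (2 : ℝ) ≤ #V := by exact_mod_cast hV
  refine le_antisymm (Finset.sup'_le _ _ fun S hS => ?_) ?_
  · rcases (Finset.mem_powerset.1 hS).eq_or_ssubset with rfl | h
    · rw [induced_powersetCard_self _ two_ne_zero, tauStar_powersetCard_two hV]
      linarith
    · have h1 : (#S : ℝ) + 1 ≤ #V := by exact_mod_cast Finset.card_lt_card h
      linarith [tauStar_induced_le_card (V.powersetCard 2) S]
  · obtain ⟨a, ha⟩ : V.Nonempty := Finset.card_pos.1 (by omega)
    refine le_trans ?_ (Finset.le_sup' _ (Finset.mem_powerset.2 (Finset.erase_subset a V)))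
    refine le_trans (le_of_eq ?_) (card_le_tauStar_of_singleton_mem
      (fun e he => subset_of_mem_induced he) (fun e he => (mem_induced.1 he).2) fun v hv => ?_)
    · rw [Finset.card_erase_of_mem ha, Nat.cast_pred (by omega)]
    · obtain ⟨hva, hvV⟩ := Finset.mem_erase.1 hv
      refine mem_induced.2 ⟨⟨{v, a}, Finset.mem_powersetCard.2 ⟨?_, Finset.card_pair hva⟩, ?_⟩,
        by simp⟩
      · simp [Finset.insert_subset_iff, ha, hvV]
      · rw [Finset.insert_inter_of_mem hv, Finset.singleton_inter_of_notMem (by simp)]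
        rfl

/-- For every integer `k ≥ 2`, the complete graph `K_k`, viewed as a
hypergraph whose hyperedges are all 2-element subsets of a `k`-element vertex set,
satisfies `κ(K_k) = k/2` and `ψ*(K_k) = k − 1`. -/
theorem kappa_psiStar_clique (k : ℕ) (hk : 2 ≤ k) :
    kappa (Finset.univ : Finset (Fin k)) (Finset.univ.powersetCard 2) = (k / 2 : ℝ) ∧
    psiStar (Finset.univ : Finset (Fin k)) (Finset.univ.powersetCard 2) = (k : ℝ) - 1 := by
  have hcard : 2 ≤ #(Finset.univ : Finset (Fin k)) := by simpa using hk
  constructor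
  · simpa using kappa_powersetCard_two hcard
  · simpa using psiStar_powersetCard_two hcard
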